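/- For every ε ∈ (0,1) there exist C(ε) > 0 and x₀(ε) ≥ 2 with the following property. Let x ≥ x₀(ε), and let y, k be real numbers with x^ε ≤ y ≤ x^{1−ε} and k ≥ x^{1+5ε}. Let F be a finite set, let ω : F → [0,∞), and for each f ∈ F let λ_f : ℕ → ℝ. Assume that for all integers m, n ∈ (x, x+y] one has | Σ_{f∈F} ω_f λ_f(n) λ_f(m) − 1_{n=m} | ≤ (mn)^{1/4} (log(3mn))² d₂(gcd(m,n)) k^{−1/2}. Then for every α ∈ ℝ: Σ_{f∈F} ω_f | Σ_{x<n≤x+y} λ_f(n) Λ(n) e(nα) |² ≤ C(ε) · y² · x^{−ε/2}. -/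

import Mathlib

open scoped ArithmeticFunction

/-- `e(x) = e^{2πix}`. -/
noncomputable def e (x : ℝ) : ℂ := Complex.exp (2 * Real.pi * Complex.I * (x : ℂ))

lemma norm_e (x : ℝ) : ‖e x‖ = 1 := by
  rw [e, show 2 * (Real.pi : ℂ) * Complex.I * (x : ℂ) = ((2 * Real.pi * x : ℝ) : ℂ) * Complex.I by
    push_cast; ring]
  exact Complex.norm_exp_ofReal_mul_I _

lemma norm_sum_sq_eq {κ : Type*} (S : Finset κ) (z : κ → ℂ) :
    ‖∑ n ∈ S, z n‖ ^ 2 = ∑ n ∈ S, ∑ m ∈ S, (z n * (starRingEnd ℂ) (z m)).re := by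
  rw [← Complex.normSq_eq_norm_sq, ← Complex.ofReal_re (Complex.normSq _), ← Complex.mul_conj,
    map_sum, Finset.sum_mul_sum]
  simp only [Complex.re_sum]

/-- An approximate orthogonality relation bounds the weighted second moment of linear forms. -/
lemma sum_weighted_norm_sq_le {ι κ : Type*} [DecidableEq κ] (F : Finset ι) (S : Finset κ)
    (w : ι → ℝ) (lam : ι → κ → ℝ) (a : κ → ℝ) (u : κ → ℂ) (ha : ∀ n, 0 ≤ a n)
    (hu : ∀ n, ‖u n‖ = 1) (D K : ℝ) (hD : ∀ n ∈ S, a n ^ 2 ≤ D)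
    (hK : ∀ m ∈ S, ∀ n ∈ S, a n * a m *
      |(∑ f ∈ F, w f * lam f n * lam f m) - (if n = m then (1 : ℝ) else 0)| ≤ K) :
    ∑ f ∈ F, w f * ‖∑ n ∈ S, ((lam f n * a n : ℝ) : ℂ) * u n‖ ^ 2
      ≤ S.card * D + (S.card : ℝ) ^ 2 * K := by
  have expand : ∑ f ∈ F, w f * ‖∑ n ∈ S, ((lam f n * a n : ℝ) : ℂ) * u n‖ ^ 2
      = ∑ n ∈ S, ∑ m ∈ S, a n * a m * (u n * (starRingEnd ℂ) (u m)).re *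
          ∑ f ∈ F, w f * lam f n * lam f m := by
    simp_rw [norm_sum_sq_eq, Finset.mul_sum]
    rw [Finset.sum_comm]
    refine Finset.sum_congr rfl fun n _ => ?_
    rw [Finset.sum_comm]
    refine Finset.sum_congr rfl fun m _ => Finset.sum_congr rfl fun f _ => ?_
    rw [map_mul, Complex.conj_ofReal,
      show ((lam f n * a n : ℝ) : ℂ) * u n * (((lam f m * a m : ℝ) : ℂ) * (starRingEnd ℂ) (u m))
        = ((lam f n * a n * (lam f m * a m) : ℝ) : ℂ) * (u n * (starRingEnd ℂ) (u m)) by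
          push_cast; ring, Complex.re_ofReal_mul]
    ring
  rw [expand]
  have bound : ∀ n ∈ S, ∀ m ∈ S, a n * a m * (u n * (starRingEnd ℂ) (u m)).re *
      ∑ f ∈ F, w f * lam f n * lam f m ≤ (if n = m then D else 0) + K := by
    intro n hn m hm
    have hc : |(u n * (starRingEnd ℂ) (u m)).re| ≤ 1 := by
      refine (Complex.abs_re_le_norm _).trans ?_
      simp [hu]
    set c := (u n * (starRingEnd ℂ) (u m)).re
    set G := ∑ f ∈ F, w f * lam f n * lam f m
    have haa : 0 ≤ a n * a m := mul_nonneg (ha n) (ha m)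
    have hG : |G| ≤ (if n = m then (1 : ℝ) else 0) + |G - (if n = m then (1 : ℝ) else 0)| := by
      have := abs_add_le (if n = m then (1 : ℝ) else 0) (G - (if n = m then (1 : ℝ) else 0))
      rw [add_sub_cancel] at this
      refine this.trans (le_of_eq ?_)
      congr 1
      split_ifs <;> simp
    have hcG : c * G ≤ |G| := by
      refine (le_abs_self _).trans ?_
      rw [abs_mul]
      exact mul_le_of_le_one_left (abs_nonneg _) hc
    calc a n * a m * c * G = a n * a m * (c * G) := by ring
      _ ≤ a n * a m * ((if n = m then (1 : ℝ) else 0)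
            + |G - (if n = m then (1 : ℝ) else 0)|) :=
          mul_le_mul_of_nonneg_left (hcG.trans hG) haa
      _ = (if n = m then a n ^ 2 else 0)
            + a n * a m * |G - (if n = m then (1 : ℝ) else 0)| := by
          rw [mul_add]
          congr 1
          split_ifs with h
          · rw [h]; ring
          · ring
      _ ≤ (if n = m then D else 0) + K := by
          refine add_le_add ?_ (hK m hm n hn)
          split_ifs
          · exact hD n hn
          · exact le_rfl
  calc _ ≤ ∑ n ∈ S, ∑ m ∈ S, ((if n = m then D else 0) + K) :=
        Finset.sum_le_sum fun n hn => Finset.sum_le_sum fun m hm => bound n hn m hm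
    _ = S.card * D + (S.card : ℝ) ^ 2 * K := by
      simp [Finset.sum_add_distrib, Finset.sum_ite_eq]
      ring

lemma IsPrimePow.card_divisors_le {m : ℕ} (hm : IsPrimePow m) :
    (m.divisors.card : ℝ) ≤ 2 * Real.log m + 1 := by
  obtain ⟨p, j, hp, -, rfl⟩ := hm
  have hp' : p.Prime := hp.nat_prime
  rw [Nat.divisors_prime_pow hp', Finset.card_map, Finset.card_range, Nat.cast_pow, Real.log_pow]
  have h2 : Real.log 2 ≤ Real.log p :=
    Real.log_le_log (by norm_num) (by exact_mod_cast hp'.two_le)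
  have := Real.log_two_gt_d9
  push_cast
  nlinarith [Nat.cast_nonneg (α := ℝ) j]

lemma vonMangoldt_mul_card_divisors_gcd_le {m n : ℕ} {L : ℝ} (hL : 1 ≤ L)
    (hm : Real.log m ≤ L) :
    Λ m * ((Nat.gcd m n).divisors.card : ℝ) ≤ 3 * L ^ 2 := by
  by_cases hpp : IsPrimePow m
  · have h0 : m ≠ 0 := hpp.ne_zero
    have h1 : ((Nat.gcd m n).divisors.card : ℝ) ≤ m.divisors.card := by
      exact_mod_cast Finset.card_le_card (Nat.divisors_subset_of_dvd h0 (Nat.gcd_dvd_left m n))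
    have h2 : ((Nat.gcd m n).divisors.card : ℝ) ≤ 3 * L := by
      linarith [hpp.card_divisors_le]
    calc _ ≤ L * (3 * L) := mul_le_mul (ArithmeticFunction.vonMangoldt_le_log.trans hm) h2
            (by positivity) (by linarith)
      _ = 3 * L ^ 2 := by ring
  · rw [ArithmeticFunction.vonMangoldt_eq_zero_iff.2 hpp, zero_mul]
    positivity

/-- Lemma 5.2, with the conclusion of the Petersson trace formula taken as a
hypothesis on the family `(F, ω, λ)`: for every `ε ∈ (0,1)` there are `C(ε) > 0`
and `x₀(ε) ≥ 2` such that for all `x ≥ x₀(ε)`, all `x^ε ≤ y ≤ x^{1-ε}` and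
`k ≥ x^{1+5ε}`, every finite family `F` with nonnegative weights `ω` and
coefficients `λ_f : ℕ → ℝ` satisfying
`|∑_{f∈F} ω_f λ_f(n) λ_f(m) - 1_{n=m}| ≤ (mn)^{1/4} (log 3mn)² d₂(gcd(m,n)) k^{-1/2}`
for all `m, n ∈ (x, x+y]`, and every `α ∈ ℝ`,
`∑_{f∈F} ω_f |∑_{x<n≤x+y} λ_f(n) Λ(n) e(nα)|² ≤ C(ε) y² x^{-ε/2}`. -/
theorem stmt_13 :
    ∀ ε : ℝ, 0 < ε → ε < 1 →
      ∃ C : ℝ, 0 < C ∧ ∃ x₀ : ℝ, 2 ≤ x₀ ∧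
        ∀ x : ℝ, x₀ ≤ x →
        ∀ y k : ℝ, x ^ ε ≤ y → y ≤ x ^ (1 - ε) → x ^ (1 + 5 * ε) ≤ k →
        ∀ (ι : Type) (F : Finset ι) (w : ι → ℝ) (lam : ι → ℕ → ℝ),
          (∀ f ∈ F, 0 ≤ w f) →
          (∀ m n : ℕ, x < (m : ℝ) → (m : ℝ) ≤ x + y → x < (n : ℝ) → (n : ℝ) ≤ x + y →
            |(∑ f ∈ F, w f * lam f n * lam f m) - (if n = m then (1 : ℝ) else 0)|
              ≤ ((m : ℝ) * n) ^ ((1 : ℝ) / 4) * (Real.log (3 * (m : ℝ) * n)) ^ 2 *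
                  ((Nat.gcd m n).divisors.card : ℝ) * k ^ (-(1 : ℝ) / 2)) →
          ∀ α : ℝ,
            (∑ f ∈ F, w f *
                ‖∑' n : ℕ, if x < (n : ℝ) ∧ (n : ℝ) ≤ x + y
                    then ((lam f n * Λ n : ℝ) : ℂ) * e ((n : ℝ) * α) else 0‖ ^ 2)
              ≤ C * y ^ 2 * x ^ (-(ε / 2)) := by
  intro ε hε hε1
  set A : ℝ := (12 : ℝ) ^ (ε / 8) / (ε / 8) with hA
  have hA0 : 0 < A := by positivity
  refine ⟨2 * A ^ 2 + 24 * A ^ 5, by positivity, 2, le_rfl, ?_⟩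
  intro x hx y k hy1 hy2 hk ι F w lam hw hB α
  have hx0 : 0 < x := by linarith
  have hx1 : 1 ≤ x := by linarith
  have hy_one : 1 ≤ y := (Real.one_le_rpow hx1 hε.le).trans hy1
  have hyx : y ≤ x := hy2.trans
    ((Real.rpow_le_rpow_of_exponent_le hx1 (by linarith)).trans_eq (Real.rpow_one x))
  set L : ℝ := Real.log (12 * x ^ 2) with hL
  have hL1 : 1 ≤ L := by
    rw [hL, Real.le_log_iff_exp_le (by positivity)]
    nlinarith [Real.exp_one_lt_d9]
  have hLA : L ≤ A * x ^ (ε / 4) := by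
    have h := Real.log_le_rpow_div (x := 12 * x ^ 2) (ε := ε / 8) (by positivity) (by positivity)
    refine h.trans_eq ?_
    rw [Real.mul_rpow (by norm_num) (by positivity), ← Real.rpow_natCast x 2,
      ← Real.rpow_mul hx0.le, hA, show ((2 : ℕ) : ℝ) * (ε / 8) = ε / 4 by push_cast; ring]
    ring
  have hlog : ∀ n : ℕ, x < n → (n : ℝ) ≤ x + y → Real.log n ≤ L := fun n h1 h2 =>
    Real.log_le_log (by linarith) (by nlinarith)
  set S : Finset ℕ := Finset.Ioc ⌊x⌋₊ ⌊x + y⌋₊ with hS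
  have hmem : ∀ n : ℕ, n ∈ S ↔ x < (n : ℝ) ∧ (n : ℝ) ≤ x + y := fun n => by
    rw [hS, Finset.mem_Ioc, Nat.floor_lt hx0.le, Nat.le_floor_iff (by linarith)]
  have hcard : (S.card : ℝ) ≤ 2 * y := by
    rw [hS, Nat.card_Ioc, Nat.cast_sub (Nat.floor_mono (by linarith))]
    linarith [Nat.floor_le (show 0 ≤ x + y by linarith), Nat.lt_floor_add_one x]
  have htsum : ∀ f, (∑' n : ℕ, if x < (n : ℝ) ∧ (n : ℝ) ≤ x + y
      then ((lam f n * Λ n : ℝ) : ℂ) * e ((n : ℝ) * α) else 0)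
      = ∑ n ∈ S, ((lam f n * Λ n : ℝ) : ℂ) * e ((n : ℝ) * α) := fun f => by
    rw [tsum_eq_sum (s := S) fun n hn => if_neg (by rwa [← hmem])]
    exact Finset.sum_congr rfl fun n hn => if_pos ((hmem n).1 hn)
  simp_rw [htsum]
  have hk' : k ^ (-(1 : ℝ) / 2) ≤ x ^ (-(1 : ℝ) / 2) * x ^ (-(5 * ε / 2)) := by
    refine (Real.rpow_le_rpow_of_nonpos (by positivity) hk (by norm_num)).trans_eq ?_
    rw [← Real.rpow_mul hx0.le, ← Real.rpow_add hx0]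
    congr 1
    ring
  have hk0 : 0 ≤ k := (by positivity : 0 ≤ x ^ (1 + 5 * ε)).trans hk
  have main := sum_weighted_norm_sq_le F S w lam (fun n => Λ n) (fun n => e ((n : ℝ) * α))
    (fun n => ArithmeticFunction.vonMangoldt_nonneg) (fun n => norm_e _) (L ^ 2)
    (6 * L ^ 5 * x ^ (-(5 * ε / 2)))
    (fun n hn => by
      obtain ⟨h1, h2⟩ := (hmem n).1 hn
      exact pow_le_pow_left₀ ArithmeticFunction.vonMangoldt_nonneg
        (ArithmeticFunction.vonMangoldt_le_log.trans (hlog n h1 h2)) 2)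
    (fun m hm n hn => by
      obtain ⟨hm1, hm2⟩ := (hmem m).1 hm
      obtain ⟨hn1, hn2⟩ := (hmem n).1 hn
      have hm0 : (0 : ℝ) < m := hx0.trans hm1
      have hn0 : (0 : ℝ) < n := hx0.trans hn1
      have hmn : (m : ℝ) * n ≤ 4 * x ^ 2 := by nlinarith
      have hn3 : Λ n ≤ L := ArithmeticFunction.vonMangoldt_le_log.trans (hlog n hn1 hn2)
      have hm3 := vonMangoldt_mul_card_divisors_gcd_le (n := n) hL1 (hlog m hm1 hm2)
      have hroot : ((m : ℝ) * n) ^ ((1 : ℝ) / 4) ≤ 2 * x ^ ((1 : ℝ) / 2) := by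
        refine (Real.rpow_le_rpow (by positivity) hmn (by norm_num)).trans ?_
        rw [Real.mul_rpow (by norm_num) (by positivity), ← Real.rpow_natCast x 2,
          ← Real.rpow_mul hx0.le, show ((2 : ℕ) : ℝ) * (1 / 4) = 1 / 2 by norm_num]
        gcongr
        calc (4 : ℝ) ^ ((1 : ℝ) / 4) ≤ 4 ^ ((1 : ℝ) / 2) :=
              Real.rpow_le_rpow_of_exponent_le (by norm_num) (by norm_num)
          _ = 2 := by
              rw [← Real.sqrt_eq_rpow, show (4 : ℝ) = 2 ^ 2 by norm_num,
                Real.sqrt_sq (by norm_num)]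
      have hl0 : 0 ≤ Real.log (3 * (m : ℝ) * n) := Real.log_nonneg (by nlinarith)
      have hl : Real.log (3 * (m : ℝ) * n) ≤ L :=
        Real.log_le_log (by positivity) (by nlinarith)
      have hΛn : 0 ≤ Λ n := ArithmeticFunction.vonMangoldt_nonneg
      have hΛm : 0 ≤ Λ m := ArithmeticFunction.vonMangoldt_nonneg
      calc _ ≤ Λ n * Λ m * (((m : ℝ) * n) ^ ((1 : ℝ) / 4) * (Real.log (3 * (m : ℝ) * n)) ^ 2 *
              ((Nat.gcd m n).divisors.card : ℝ) * k ^ (-(1 : ℝ) / 2)) :=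
            mul_le_mul_of_nonneg_left (hB m n hm1 hm2 hn1 hn2) (mul_nonneg hΛn hΛm)
        _ = Λ n * (Λ m * ((Nat.gcd m n).divisors.card : ℝ)) * ((m : ℝ) * n) ^ ((1 : ℝ) / 4) *
              (Real.log (3 * (m : ℝ) * n)) ^ 2 * k ^ (-(1 : ℝ) / 2) := by ring
        _ ≤ L * (3 * L ^ 2) * (2 * x ^ ((1 : ℝ) / 2)) * L ^ 2 *
              (x ^ (-(1 : ℝ) / 2) * x ^ (-(5 * ε / 2))) := by gcongr
        _ = 6 * L ^ 5 * x ^ (-(5 * ε / 2)) * (x ^ ((1 : ℝ) / 2) * x ^ (-(1 : ℝ) / 2)) := by ring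
        _ = 6 * L ^ 5 * x ^ (-(5 * ε / 2)) := by
            rw [← Real.rpow_add hx0]
            norm_num)
  have hdiag : y * L ^ 2 ≤ A ^ 2 * y ^ 2 * x ^ (-(ε / 2)) := by
    calc y * L ^ 2 ≤ y * (A * x ^ (ε / 4)) ^ 2 := by gcongr
      _ = A ^ 2 * y * (x ^ ε * x ^ (-(ε / 2))) := by
          rw [mul_pow, ← Real.rpow_natCast (x ^ (ε / 4)) 2, ← Real.rpow_mul hx0.le,
            ← Real.rpow_add hx0, show ε / 4 * ((2 : ℕ) : ℝ) = ε + -(ε / 2) by push_cast; ring]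
          ring
      _ ≤ A ^ 2 * y * (y * x ^ (-(ε / 2))) := by gcongr
      _ = A ^ 2 * y ^ 2 * x ^ (-(ε / 2)) := by ring
  have hoff : L ^ 5 * x ^ (-(5 * ε / 2)) ≤ A ^ 5 * x ^ (-(ε / 2)) := by
    calc L ^ 5 * x ^ (-(5 * ε / 2)) ≤ (A * x ^ (ε / 4)) ^ 5 * x ^ (-(5 * ε / 2)) := by gcongr
      _ = A ^ 5 * x ^ (-(5 * ε / 4)) := by
          rw [mul_pow, ← Real.rpow_natCast (x ^ (ε / 4)) 5, ← Real.rpow_mul hx0.le, mul_assoc,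
            ← Real.rpow_add hx0,
            show ε / 4 * ((5 : ℕ) : ℝ) + -(5 * ε / 2) = -(5 * ε / 4) by push_cast; ring]
      _ ≤ A ^ 5 * x ^ (-(ε / 2)) := by
          gcongr ?_ * ?_
          exact Real.rpow_le_rpow_of_exponent_le hx1 (by linarith)
  calc _ ≤ (S.card : ℝ) * L ^ 2 + (S.card : ℝ) ^ 2 * (6 * L ^ 5 * x ^ (-(5 * ε / 2))) := main
    _ ≤ (2 * y) * L ^ 2 + (2 * y) ^ 2 * (6 * L ^ 5 * x ^ (-(5 * ε / 2))) := by gcongr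
    _ = 2 * (y * L ^ 2) + 24 * y ^ 2 * (L ^ 5 * x ^ (-(5 * ε / 2))) := by ring
    _ ≤ 2 * (A ^ 2 * y ^ 2 * x ^ (-(ε / 2))) + 24 * y ^ 2 * (A ^ 5 * x ^ (-(ε / 2))) := by gcongr
    _ = (2 * A ^ 2 + 24 * A ^ 5) * y ^ 2 * x ^ (-(ε / 2)) := by ring
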